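/- For every positive integer M, the set X_iso is dense in [0,1] (every point of [0,1] is a limit of points of X_iso); and when M = 1, X_iso is dense in (0,∞). -/

import Mathlib

open scoped ENNReal NNReal Classical

namespace Expansions

/-- Digit sequences over the alphabet `{0,1,…,M}`; index `i : ℕ` represents the
`(i+1)`-st digit `d_{i+1}` of the paper. -/
abbrev Digits (M : ℕ) := ℕ → Fin (M + 1)

/-- `π_q((d_i)) = Σ_{i≥1} d_i / q^i`. -/
noncomputable def piQ (M : ℕ) (q : ℝ) (d : Digits M) : ℝ :=
  ∑' i : ℕ, (d i : ℝ) / q ^ (i + 1)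

/-- `𝒰_q` : the set of real numbers having a unique `q`-expansion. -/
def Uq (M : ℕ) (q : ℝ) : Set ℝ := {x | ∃! d : Digits M, piQ M q d = x}

/-- `𝐔_q` : the set of sequences that are the unique `q`-expansion of their value. -/
def UqSym (M : ℕ) (q : ℝ) : Set (Digits M) :=
  {d | ∀ e : Digits M, piQ M q e = piQ M q d → e = d}

/-- `𝒰(x)` : the set of univoque bases of `x`. -/
def Ubases (M : ℕ) (x : ℝ) : Set ℝ :=
  {q | q ∈ Set.Ioc (1 : ℝ) ((M : ℝ) + 1) ∧ x ∈ Uq M q}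

/-- `q_x = min{M+1, 1+M/x}`. -/
noncomputable def qx (M : ℕ) (x : ℝ) : ℝ := min ((M : ℝ) + 1) (1 + (M : ℝ) / x)

/-- Strict lexicographic order on digit sequences. -/
def lexLt {M : ℕ} (c d : Digits M) : Prop := ∃ n, (∀ i < n, c i = d i) ∧ c n < d n

def lexLe {M : ℕ} (c d : Digits M) : Prop := c = d ∨ lexLt c d

/-- The sequence ends with `0^∞`. -/
def EndsInZero {M : ℕ} (d : Digits M) : Prop := ∃ N, ∀ n ≥ N, d n = 0

/-- `d` is the quasi-greedy `q`-expansion of `x`: the lexicographically largest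
`q`-expansion of `x` not ending with `0^∞`. -/
def IsQuasiGreedy (M : ℕ) (q x : ℝ) (d : Digits M) : Prop :=
  piQ M q d = x ∧ ¬ EndsInZero d ∧
    ∀ e : Digits M, piQ M q e = x → ¬ EndsInZero e → lexLe e d

/-- `Φ_x(q)`: the quasi-greedy `q`-expansion of `x` (junk value if none exists). -/
noncomputable def Phi (M : ℕ) (x q : ℝ) : Digits M :=
  if h : ∃ d : Digits M, IsQuasiGreedy M q x d then h.choose else fun _ => 0

/-- `𝐔(x) = {Φ_x(q) : q ∈ 𝒰(x)}`. -/
def UxSym (M : ℕ) (x : ℝ) : Set (Digits M) := (Phi M x) '' (Ubases M x)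

/-- `ρ((c_i),(d_i)) = (M+1)^{-inf{i ≥ 1 : c_i ≠ d_i}}` (our index `n` represents the
`(n+1)`-st digit, whence the exponent `-(n+1)`); `ρ(c,c) = 0`. -/
noncomputable def rho (M : ℕ) (c d : Digits M) : ℝ :=
  if c = d then 0
  else ((M : ℝ) + 1) ^ (-(((sInf {i | c i ≠ d i} : ℕ) : ℤ) + 1))

/-- Diameter of a set with respect to a distance function, valued in `ℝ≥0∞`. -/
noncomputable def gdiam {X : Type*} (dist : X → X → ℝ) (A : Set X) : ℝ≥0∞ :=
  ⨆ x ∈ A, ⨆ y ∈ A, ENNReal.ofReal (dist x y)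

/-- The `s`-dimensional Hausdorff outer measure with respect to a distance function:
`lim_{δ→0⁺} inf {Σ diam(C n)^s : A ⊆ ⋃ C n, diam (C n) ≤ δ}`. -/
noncomputable def gHMeasure {X : Type*} (dist : X → X → ℝ) (s : ℝ) (A : Set X) : ℝ≥0∞ :=
  ⨆ (δ : ℝ) (_ : 0 < δ),
    ⨅ (C : ℕ → Set X) (_ : A ⊆ ⋃ n, C n)
      (_ : ∀ n, gdiam dist (C n) ≤ ENNReal.ofReal δ),
      ∑' n, gdiam dist (C n) ^ s

/-- Hausdorff dimension with respect to a distance function. -/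
noncomputable def gdimH {X : Type*} (dist : X → X → ℝ) (A : Set X) : ℝ≥0∞ :=
  ⨆ (s : ℝ≥0) (_ : gHMeasure dist (s : ℝ) A = ⊤), (s : ℝ≥0∞)

/-- The generalized golden ratio `q_G`. -/
noncomputable def qG (M : ℕ) : ℝ :=
  if M % 2 = 0 then ((M / 2 : ℕ) : ℝ) + 1
  else (((M / 2 : ℕ) : ℝ) + 1 +
    Real.sqrt (((M / 2 : ℕ) : ℝ) ^ 2 + 6 * ((M / 2 : ℕ) : ℝ) + 5)) / 2

/-- `x_G = M/(q_G - 1)`. -/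
noncomputable def xG (M : ℕ) : ℝ := (M : ℝ) / (qG M - 1)

/-- The Komornik–Loreti constant `q_KL = min 𝒰(1)`. -/
noncomputable def qKL (M : ℕ) : ℝ := sInf (Ubases M 1)

/-- `x_KL = M/(q_KL - 1)`. -/
noncomputable def xKL (M : ℕ) : ℝ := (M : ℝ) / (qKL M - 1)

/-- `X_iso`: the set of `x > 0` such that `𝒰(x)` contains an isolated point. -/
def Xiso (M : ℕ) : Set ℝ :=
  {x | 0 < x ∧ ∃ q ∈ Ubases M x, ∃ ε > 0, Ubases M x ∩ Set.Ioo (q - ε) (q + ε) = {q}}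

/-- The bifurcation set `𝒱 = {q ∈ (1,M+1] : 𝐔_r ≠ 𝐔_q for all r > q}`. -/
def Vset (M : ℕ) : Set ℝ :=
  {q | q ∈ Set.Ioc (1 : ℝ) ((M : ℝ) + 1) ∧
    ∀ r ∈ Set.Ioc (1 : ℝ) ((M : ℝ) + 1), q < r → UqSym M r ≠ UqSym M q}

/-- The Thue–Morse sequence `τ_i` = parity of the binary digit sum of `i`. -/
def tm (i : ℕ) : ℕ := (Nat.digits 2 i).sum % 2

section Expansion

variable {M : ℕ} {q : ℝ}

/-- Prepend one digit. -/
def cons (a : Fin (M + 1)) (d : Digits M) : Digits M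
  | 0 => a
  | n + 1 => d n

/-- Drop the first digit. -/
def tail (d : Digits M) : Digits M := fun n => d (n + 1)

/-- Prepend a finite word. -/
def app (l : List (Fin (M + 1))) (d : Digits M) : Digits M := l.foldr cons d

/-- The digitwise reflection `a ↦ M - a`. -/
def refl (d : Digits M) : Digits M := fun n => (d n).rev

/-- The value of a word followed by a sequence of value `y`. -/
noncomputable def val (q : ℝ) (l : List (Fin (M + 1))) (y : ℝ) : ℝ :=
  l.foldr (fun a y => ((a : ℝ) + y) / q) y

lemma cons_head_tail (d : Digits M) : cons (d 0) (tail d) = d := by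
  funext n; cases n <;> rfl

lemma app_append (l₁ l₂ : List (Fin (M + 1))) (d : Digits M) :
    app (l₁ ++ l₂) d = app l₁ (app l₂ d) := by simp [app]

lemma refl_refl (d : Digits M) : refl (refl d) = d := by funext n; simp [refl]

lemma refl_cons (a : Fin (M + 1)) (d : Digits M) : refl (cons a d) = cons a.rev (refl d) := by
  funext n; cases n <;> rfl

lemma refl_app (l : List (Fin (M + 1))) (d : Digits M) :
    refl (app l d) = app (l.map Fin.rev) (refl d) := by
  induction l with
  | nil => rfl
  | cons a l ih => exact (refl_cons a _).trans (congrArg _ ih)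

lemma digit_le (a : Fin (M + 1)) : (a : ℝ) ≤ M := by exact_mod_cast Nat.lt_succ_iff.1 a.2

lemma cast_rev (a : Fin (M + 1)) : ((a.rev : Fin (M + 1)) : ℝ) = M - a := by
  have := a.2
  rw [Fin.val_rev, Nat.cast_sub (by omega)]; push_cast; ring

lemma hasSum_const (hq : 1 < q) (c : ℝ) :
    HasSum (fun i : ℕ => c / q ^ (i + 1)) (c / (q - 1)) := by
  have h := (hasSum_geometric_of_lt_one (r := q⁻¹) (by positivity)
    (inv_lt_one_of_one_lt₀ hq)).mul_left (c / q)
  have h1 : q - 1 ≠ 0 := by linarith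
  have h2 : q ≠ 0 := by linarith
  have h3 : c / q * (1 - q⁻¹)⁻¹ = c / (q - 1) := by
    rw [← one_div q, one_sub_div h2]; field_simp
  have h4 : (fun i : ℕ => c / q * q⁻¹ ^ i) = fun i => c / q ^ (i + 1) := by
    funext i; rw [pow_succ, inv_pow]; field_simp
  rwa [h3, h4] at h

lemma summable_digits (hq : 1 < q) (d : Digits M) :
    Summable (fun i : ℕ => (d i : ℝ) / q ^ (i + 1)) := by
  refine Summable.of_nonneg_of_le (fun i => by positivity) (fun i => ?_)
    (hasSum_const hq (M : ℝ)).summable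
  have := digit_le (d i)
  gcongr

lemma piQ_nonneg (hq : 1 < q) (d : Digits M) : 0 ≤ piQ M q d :=
  tsum_nonneg fun i => by positivity

lemma piQ_head_tail (hq : 1 < q) (d : Digits M) :
    piQ M q d = ((d 0 : ℝ) + piQ M q (tail d)) / q := by
  unfold piQ
  rw [(summable_digits hq d).tsum_eq_zero_add, add_div, ← tsum_div_const]
  congr 1
  · simp
  · refine tsum_congr fun i => ?_
    simp only [tail]
    rw [pow_succ _ (i + 1), div_div]

lemma piQ_cons (hq : 1 < q) (a : Fin (M + 1)) (d : Digits M) :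
    piQ M q (cons a d) = ((a : ℝ) + piQ M q d) / q := piQ_head_tail hq _

lemma piQ_app (hq : 1 < q) (l : List (Fin (M + 1))) (d : Digits M) :
    piQ M q (app l d) = val q l (piQ M q d) := by
  induction l with
  | nil => rfl
  | cons a l ih =>
    change piQ M q (cons a (app l d)) = ((a : ℝ) + val q l (piQ M q d)) / q
    rw [piQ_cons hq, ih]

lemma piQ_refl (hq : 1 < q) (d : Digits M) :
    piQ M q (refl d) = M / (q - 1) - piQ M q d := by
  unfold piQ
  rw [← (hasSum_const hq (M : ℝ)).tsum_eq,
    ← (hasSum_const hq (M : ℝ)).summable.tsum_sub (summable_digits hq d)]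
  refine tsum_congr fun i => ?_
  rw [refl, cast_rev, sub_div]

lemma piQ_le (hq : 1 < q) (d : Digits M) : piQ M q d ≤ M / (q - 1) := by
  have := piQ_nonneg hq (refl d)
  rw [piQ_refl hq] at this
  linarith

lemma piQ_lt_piQ {q' : ℝ} (hq : 1 < q) (hqq : q < q') {d : Digits M} {n : ℕ} (hn : 0 < d n) :
    piQ M q' d < piQ M q d := by
  refine Summable.tsum_lt_tsum (i := n) (fun i => ?_) ?_ (summable_digits (hq.trans hqq) d)
    (summable_digits hq d)
  · gcongr
  · have : (0 : ℝ) < d n := by exact_mod_cast hn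
    gcongr

/-- `d` satisfies the first `N` of the inequalities on its tails that characterise unique
expansions. -/
def UnivoqueUpTo (q : ℝ) : ℕ → Digits M → Prop
  | 0, _ => True
  | N + 1, d => ((d 0 : ℕ) < M → piQ M q (tail d) < 1) ∧
      (0 < (d 0 : ℕ) → (M : ℝ) / (q - 1) - 1 < piQ M q (tail d)) ∧ UnivoqueUpTo q N (tail d)

/-- The inequalities on all tails that characterise unique expansions. -/
def Univoque (q : ℝ) (d : Digits M) : Prop := ∀ N, UnivoqueUpTo q N d

lemma UnivoqueUpTo.pred {N : ℕ} {d : Digits M} (h : UnivoqueUpTo q (N + 1) d) :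
    UnivoqueUpTo q N d := by
  induction N generalizing d with
  | zero => trivial
  | succ N ih => exact ⟨h.1, h.2.1, ih h.2.2⟩

lemma Univoque.lt_one {d : Digits M} (h : Univoque q d) (h0 : (d 0 : ℕ) < M) :
    piQ M q (tail d) < 1 := (h 1).1 h0

lemma Univoque.lt_piQ {d : Digits M} (h : Univoque q d) (h0 : 0 < (d 0 : ℕ)) :
    (M : ℝ) / (q - 1) - 1 < piQ M q (tail d) := (h 1).2.1 h0

lemma Univoque.tail {d : Digits M} (h : Univoque q d) : Univoque q (tail d) :=
  fun N => (h (N + 1)).2.2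

lemma Univoque.of_app {l : List (Fin (M + 1))} {d : Digits M} (h : Univoque q (app l d)) :
    Univoque q d := by
  induction l with
  | nil => exact h
  | cons a l ih => exact ih h.tail

lemma UnivoqueUpTo.refl (hq : 1 < q) {N : ℕ} {d : Digits M} (h : UnivoqueUpTo q N d) :
    UnivoqueUpTo q N (refl d) := by
  induction N generalizing d with
  | zero => trivial
  | succ N ih =>
    have hp : piQ M q (Expansions.tail (Expansions.refl d)) =
      M / (q - 1) - piQ M q (Expansions.tail d) := piQ_refl hq _
    have hv : ((Expansions.refl d 0 : Fin (M + 1)) : ℕ) = M - d 0 := by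
      simp [Expansions.refl, Fin.val_rev]
    have := (d 0).2
    refine ⟨fun h0 => ?_, fun h0 => ?_, ih h.2.2⟩
    · have := h.2.1 (by omega)
      rw [hp]; linarith
    · have := h.1 (by omega)
      rw [hp]; linarith

lemma Univoque.refl (hq : 1 < q) {d : Digits M} (h : Univoque q d) : Univoque q (refl d) :=
  fun N => (h N).refl hq

lemma UnivoqueUpTo.cons_zero {N : ℕ} {d : Digits M} (h : UnivoqueUpTo q N d)
    (hd : piQ M q d < 1) : UnivoqueUpTo q (N + 1) (cons 0 d) :=
  ⟨fun _ => hd, fun h0 => absurd h0 (by simp [cons]), h⟩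

lemma UnivoqueUpTo.cons {N : ℕ} {d : Digits M} (h : UnivoqueUpTo q N d) (a : Fin (M + 1))
    (hd : piQ M q d < 1) (hd' : M / (q - 1) - 1 < piQ M q d) :
    UnivoqueUpTo q (N + 1) (cons a d) :=
  ⟨fun _ => hd, fun _ => hd', h⟩

lemma Univoque.head_eq (hq : 1 < q) {d e : Digits M} (hd : Univoque q d)
    (h : piQ M q e = piQ M q d) : e 0 = d 0 := by
  have hq0 : q ≠ 0 := by linarith
  rw [piQ_head_tail hq d, piQ_head_tail hq e, div_left_inj' hq0] at h
  have h1 := piQ_nonneg hq (Expansions.tail e)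
  have h2 := piQ_le hq (Expansions.tail e)
  rcases lt_trichotomy (e 0) (d 0) with h0 | h0 | h0
  · have h3 := hd.lt_piQ (lt_of_le_of_lt (Nat.zero_le _) h0)
    have : ((e 0 : ℕ) : ℝ) + 1 ≤ (d 0 : ℕ) := by exact_mod_cast h0
    linarith
  · exact h0
  · have h3 := hd.lt_one (lt_of_lt_of_le h0 (Nat.lt_succ_iff.1 (e 0).2))
    have : ((d 0 : ℕ) : ℝ) + 1 ≤ (e 0 : ℕ) := by exact_mod_cast h0
    linarith

lemma Univoque.eq_of_piQ_eq (hq : 1 < q) {d e : Digits M} (hd : Univoque q d)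
    (h : piQ M q e = piQ M q d) : e = d := by
  funext n
  induction n generalizing d e with
  | zero => exact hd.head_eq hq h
  | succ n ih =>
    have hq0 : q ≠ 0 := by linarith
    have h0 := hd.head_eq hq h
    rw [piQ_head_tail hq d, piQ_head_tail hq e, div_left_inj' hq0, h0] at h
    exact ih (d := Expansions.tail d) (e := Expansions.tail e) hd.tail (by linarith)

lemma exists_piQ_eq (hq : 1 < q) (hqM : q ≤ M + 1) {y : ℝ} (hy : 0 ≤ y)
    (hy' : y ≤ M / (q - 1)) : ∃ d : Digits M, piQ M q d = y := by
  have hq1 : 0 < q - 1 := by linarith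
  have hR : (1 : ℝ) ≤ M / (q - 1) := by rw [le_div_iff₀ hq1]; linarith
  have hqR : q * (M / (q - 1)) - M = M / (q - 1) := by field_simp; ring
  have step : ∀ s : Set.Icc (0 : ℝ) (M / (q - 1)), ∃ a : Fin (M + 1),
      q * s - a ∈ Set.Icc (0 : ℝ) (M / (q - 1)) := by
    rintro ⟨s, hs, hs'⟩
    have h0 : 0 ≤ q * s := by positivity
    have h1 : q * s ≤ q * (M / (q - 1)) := by gcongr
    by_cases hf : ⌊q * s⌋₊ < M + 1
    · refine ⟨⟨⌊q * s⌋₊, hf⟩, ?_, ?_⟩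
      · simpa using Nat.floor_le h0
      · have := Nat.lt_floor_add_one (q * s)
        simp only
        linarith
    · have : ((M + 1 : ℕ) : ℝ) ≤ q * s := (Nat.le_floor_iff h0).1 (not_lt.1 hf)
      push_cast at this
      refine ⟨Fin.last M, ?_, ?_⟩ <;> simp only [Fin.val_last] <;> linarith
  choose a ha using step
  let s : ℕ → Set.Icc (0 : ℝ) (M / (q - 1)) := fun n =>
    Nat.rec ⟨y, hy, hy'⟩ (fun _ t => ⟨q * t - a t, ha t⟩) n
  have key : ∀ n, |y - piQ M q (fun i => a (s i))| =
      (q⁻¹) ^ n * |(s n).1 - piQ M q (fun i => a (s (n + i)))| := by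
    intro n
    induction n with
    | zero => simp [s]
    | succ n ih =>
      rw [ih, piQ_head_tail hq (fun i => a (s (n + i))), pow_succ, mul_assoc]
      congr 1
      have hq0 : (0 : ℝ) < q⁻¹ := by positivity
      conv_rhs => rw [← abs_of_pos hq0, ← abs_mul]
      have e1 : (s (n + 1)).1 = q * (s n).1 - a (s n) := rfl
      have e2 : tail (fun i => a (s (n + i))) = fun i => a (s (n + 1 + i)) := by
        funext i; simp only [tail]; rw [show n + (i + 1) = n + 1 + i by ring]
      rw [e1, e2]
      congr 1
      simp only [add_zero]
      field_simp
      ring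
  refine ⟨fun i => a (s i), ?_⟩
  have hle : ∀ n, |y - piQ M q (fun i => a (s i))| ≤ (q⁻¹) ^ n * (M / (q - 1)) := by
    intro n
    rw [key n]
    have h1 := piQ_nonneg hq (fun i => a (s (n + i)))
    have h2 := piQ_le hq (fun i => a (s (n + i)))
    have h3 := (s n).2.1
    have h4 := (s n).2.2
    gcongr
    rw [abs_le]
    constructor <;> linarith
  have hlim : Filter.Tendsto (fun n : ℕ => (q⁻¹) ^ n * ((M : ℝ) / (q - 1))) Filter.atTop
      (nhds 0) := by
    simpa using (tendsto_pow_atTop_nhds_zero_of_lt_one (by positivity)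
      (inv_lt_one_of_one_lt₀ hq)).mul_const ((M : ℝ) / (q - 1))
  have := ge_of_tendsto' hlim hle
  have := abs_nonpos_iff.1 this
  linarith

lemma univoque_of_unique (hq : 1 < q) (hqM : q ≤ M + 1) {d : Digits M}
    (h : ∀ e : Digits M, piQ M q e = piQ M q d → e = d) : Univoque q d := by
  intro N
  induction N generalizing d with
  | zero => trivial
  | succ N ih =>
    have hR : (1 : ℝ) ≤ M / (q - 1) := by rw [le_div_iff₀ (by linarith)]; linarith
    have h1 := piQ_nonneg hq (tail d)
    have h2 := piQ_le hq (tail d)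
    refine ⟨fun h0 => ?_, fun h0 => ?_, ih fun e he => ?_⟩
    · by_contra! hc
      obtain ⟨e, he⟩ := exists_piQ_eq (M := M) hq hqM (y := piQ M q (tail d) - 1)
        (by linarith) (by linarith)
      have := congrFun (h (cons ⟨d 0 + 1, by omega⟩ e) (by
        rw [piQ_cons hq, he, piQ_head_tail hq d]; push_cast; ring)) 0
      simp [cons, Fin.ext_iff] at this
    · by_contra! hc
      obtain ⟨e, he⟩ := exists_piQ_eq (M := M) hq hqM (y := piQ M q (tail d) + 1)
        (by linarith) (by linarith)
      have := congrFun (h (cons ⟨d 0 - 1, by omega⟩ e) (by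
        rw [piQ_cons hq, he, piQ_head_tail hq d]; push_cast [Nat.cast_sub h0]; ring)) 0
      have := congrArg Fin.val this
      simp [cons] at this
      omega
    · have := h (cons (d 0) e) (by rw [piQ_cons hq, he, ← piQ_head_tail hq])
      exact congrArg tail this

lemma mem_Ubases_iff {x : ℝ} : q ∈ Ubases M x ↔
    1 < q ∧ q ≤ M + 1 ∧ ∃ d : Digits M, Univoque q d ∧ piQ M q d = x := by
  constructor
  · rintro ⟨⟨h1, h2⟩, d, hd, hu⟩
    exact ⟨h1, h2, d, univoque_of_unique h1 h2 fun e he => hu e (he.trans hd), hd⟩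
  · rintro ⟨h1, h2, d, hd, rfl⟩
    exact ⟨⟨h1, h2⟩, d, rfl, fun e he => hd.eq_of_piQ_eq h1 he⟩

lemma val_append (l₁ l₂ : List (Fin (M + 1))) (y : ℝ) :
    val q (l₁ ++ l₂) y = val q l₁ (val q l₂ y) := by simp [val]

lemma val_strictMono (hq : 1 < q) (l : List (Fin (M + 1))) : StrictMono (val q l) := by
  induction l with
  | nil => exact strictMono_id
  | cons a l ih =>
    intro y y' h
    have := ih h
    change ((a : ℝ) + val q l y) / q < ((a : ℝ) + val q l y') / q
    gcongr

lemma val_nonneg (hq : 1 < q) (l : List (Fin (M + 1))) {y : ℝ} (hy : 0 ≤ y) :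
    0 ≤ val q l y := by
  induction l with
  | nil => exact hy
  | cons a l ih =>
    change 0 ≤ ((a : ℝ) + val q l y) / q
    positivity

lemma val_rev (hq : 1 < q) (l : List (Fin (M + 1))) (y : ℝ) :
    val q (l.map Fin.rev) (M / (q - 1) - y) = M / (q - 1) - val q l y := by
  have hq1 : q - 1 ≠ 0 := by linarith
  have hq0 : q ≠ 0 := by linarith
  induction l with
  | nil => rfl
  | cons a l ih =>
    change ((a.rev : ℝ) + val q (l.map Fin.rev) (M / (q - 1) - y)) / q =
      M / (q - 1) - ((a : ℝ) + val q l y) / q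
    rw [ih, cast_rev]
    field_simp
    ring

lemma val_le (hq : 1 < q) (l : List (Fin (M + 1))) {y : ℝ} (hy : y ≤ M / (q - 1)) :
    val q l y ≤ M / (q - 1) := by
  have := val_nonneg hq (l.map Fin.rev) (sub_nonneg.2 hy)
  rw [val_rev hq] at this
  linarith

lemma tendsto_val {ι : Type*} {F : Filter ι} {f g : ι → ℝ} {y : ℝ}
    (hf : Filter.Tendsto f F (nhds q)) (hg : Filter.Tendsto g F (nhds y)) (hq : q ≠ 0)
    (l : List (Fin (M + 1))) :
    Filter.Tendsto (fun i => val (f i) l (g i)) F (nhds (val q l y)) := by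
  induction l with
  | nil => exact hg
  | cons a l ih => exact (tendsto_const_nhds.add ih).div hf hq

/-- A univoque sequence whose value lies in the open cylinder of a word starts with that word. -/
lemma Univoque.exists_eq_app (hq : 1 < q) (l : List (Fin (M + 1))) {d : Digits M}
    (hd : Univoque q d) (h0 : val q l 0 < piQ M q d)
    (h1 : piQ M q d < val q l (M / (q - 1))) : ∃ e, d = app l e := by
  induction l generalizing d with
  | nil => exact ⟨d, rfl⟩
  | cons a l ih =>
    have hq0 : 0 < q := by linarith
    change ((a : ℝ) + val q l 0) / q < _ at h0
    change _ < ((a : ℝ) + val q l (M / (q - 1))) / q at h1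
    rw [piQ_head_tail hq, div_lt_div_iff_of_pos_right hq0] at h0 h1
    have h2 := val_nonneg hq l le_rfl
    have h3 := val_le hq l le_rfl
    rcases lt_trichotomy (d 0) a with h | h | h
    · have h4 := hd.lt_one (lt_of_lt_of_le h (Nat.lt_succ_iff.1 a.2))
      have : ((d 0 : ℕ) : ℝ) + 1 ≤ (a : ℕ) := by exact_mod_cast h
      linarith
    · rw [h] at h0 h1
      obtain ⟨e, he⟩ := ih hd.tail (by linarith) (by linarith)
      refine ⟨e, ?_⟩
      change d = cons a (app l e)
      rw [← he, ← h, cons_head_tail]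
    · have h4 := hd.lt_piQ (lt_of_le_of_lt (Nat.zero_le _) h)
      have : ((a : ℕ) : ℝ) + 1 ≤ (d 0 : ℕ) := by exact_mod_cast h
      linarith

/-- The sequence `u ū u ū …`. -/
def antiPeriodic (u : List (Fin (M + 1))) (k : ℕ) : Fin (M + 1) :=
  if h : k < u.length then u[k]
  else if u.length = 0 then 0 else (antiPeriodic u (k - u.length)).rev
termination_by k
decreasing_by omega

lemma app_apply (l : List (Fin (M + 1))) (d : Digits M) (k : ℕ) :
    app l d k = if h : k < l.length then l[k] else d (k - l.length) := by
  induction l generalizing k with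
  | nil => simp [app]
  | cons a l ih =>
    cases k with
    | zero => simp [app, cons]
    | succ k =>
      change app l d k = _
      rw [ih]
      simp

lemma antiPeriodic_eq {u : List (Fin (M + 1))} (hu : u ≠ []) :
    antiPeriodic u = app u (refl (antiPeriodic u)) := by
  have : u.length ≠ 0 := by simpa using hu
  funext k
  rw [app_apply]
  conv_lhs => rw [antiPeriodic]
  simp [this, refl]

lemma refl_antiPeriodic {u : List (Fin (M + 1))} (hu : u ≠ []) :
    refl (antiPeriodic u) = app (u.map Fin.rev) (antiPeriodic u) := by
  conv_lhs => rw [antiPeriodic_eq hu, refl_app, refl_refl]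

lemma exists_pos_of_piQ_pos {d : Digits M} (h : 0 < piQ M q d) : ∃ n, 0 < d n := by
  by_contra! hc
  have : piQ M q d = 0 := by
    have : ∀ i, d i = 0 := fun i => le_antisymm (hc i) (Fin.zero_le _)
    simp [piQ, this]
  linarith

lemma lt_piQ_of_univoque_app {l : List (Fin (M + 1))} {a : Fin (M + 1)} {d : Digits M}
    (h : Univoque q (app (l ++ [a]) d)) (ha : 0 < (a : ℕ)) : M / (q - 1) - 1 < piQ M q d := by
  rw [app_append] at h
  exact h.of_app.lt_piQ ha

lemma piQ_lt_one_of_univoque_app {l : List (Fin (M + 1))} {a : Fin (M + 1)} {d : Digits M}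
    (h : Univoque q (app (l ++ [a]) d)) (ha : (a : ℕ) < M) : piQ M q d < 1 := by
  rw [app_append] at h
  exact h.of_app.lt_one ha

/-- If `u ū M^∞` has value greater than `1`, then after an occurrence of `u` a univoque sequence
is forced to continue with `ū u ū u …`. -/
lemma Univoque.eq_refl_antiPeriodic (hq : 1 < q) {u' : List (Fin (M + 1))} {a : Fin (M + 1)}
    (ha : 0 < (a : ℕ))
    (hC : 1 < val q (u' ++ [a]) (val q ((u' ++ [a]).map Fin.rev) (M / (q - 1))))
    {e : Digits M} (he : Univoque q e) (h0 : M / (q - 1) - 1 < piQ M q e)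
    (h1 : val q (u' ++ [a]) (piQ M q e) < 1) :
    e = Expansions.refl (antiPeriodic (u' ++ [a])) := by
  have hm : 0 < (u' ++ [a]).length := by simp
  have hu : u' ++ [a] ≠ [] := by simp
  have harev : (a.rev : ℕ) < M := by
    have := a.2
    rw [Fin.val_rev]; omega
  have hmap : (u' ++ [a]).map Fin.rev = u'.map Fin.rev ++ [a.rev] := by simp
  have hC' : 1 < val q (u' ++ [a]) (M / (q - 1)) :=
    hC.trans_le ((val_strictMono hq _).monotone (val_le hq _ le_rfl))
  have hlow : val q ((u' ++ [a]).map Fin.rev) 0 < M / (q - 1) - 1 := by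
    have := val_rev hq (u' ++ [a]) (M / (q - 1))
    rw [sub_self] at this
    rw [this]; linarith
  generalize hU : u' ++ [a] = u at *
  funext k
  induction k using Nat.strong_induction_on generalizing e with
  | _ k ih =>
    obtain ⟨e₁, rfl⟩ := he.exists_eq_app hq (u.map Fin.rev) (hlow.trans h0)
      ((val_strictMono hq u).lt_iff_lt.1 (h1.trans hC))
    rw [refl_antiPeriodic hu, app_apply, app_apply]
    split_ifs with hk
    · rfl
    · have hr : Expansions.refl (app (u.map Fin.rev) e₁) = app u (Expansions.refl e₁) := by
        simp [refl_app, Function.comp_def]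
      have h2 : piQ M q e₁ < 1 := piQ_lt_one_of_univoque_app (hmap ▸ he) harev
      have := ih (k - (u.map Fin.rev).length) (by simp at hk ⊢; omega)
        (e := Expansions.refl e₁) (he.of_app.refl hq) (by rw [piQ_refl hq]; linarith)
        (by rw [← piQ_app hq, ← hr, piQ_refl hq]; linarith)
      exact Fin.rev_injective this

/-- The isolation criterion. -/
theorem piQ_mem_Xiso (hq : 1 < q) (hqM : q ≤ M + 1) {w' u' : List (Fin (M + 1))}
    {b a : Fin (M + 1)} (hb : (b : ℕ) < M) (ha : 0 < (a : ℕ))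
    (hC : 1 < val q (u' ++ [a]) (val q ((u' ++ [a]).map Fin.rev) (M / (q - 1))))
    (hd : Univoque q (app (w' ++ [b]) (antiPeriodic (u' ++ [a])))) :
    piQ M q (app (w' ++ [b]) (antiPeriodic (u' ++ [a]))) ∈ Xiso M := by
  have hR : (1 : ℝ) ≤ M / (q - 1) := by rw [le_div_iff₀ (by linarith)]; linarith
  have hq1 : q - 1 ≠ 0 := by linarith
  have hu : u' ++ [a] ≠ [] := by simp
  set u := u' ++ [a] with hU
  set w := w' ++ [b] with hW
  set p := antiPeriodic u with hp
  have hpu : p = app u (refl p) := antiPeriodic_eq hu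
  have hd' : app w p = app (w ++ u) (refl p) := by rw [app_append w u, ← hpu]
  have hrp : M / (q - 1) - 1 < piQ M q (refl p) :=
    lt_piQ_of_univoque_app (l := w ++ u') (a := a) (by
      rw [List.append_assoc, ← hU, ← hd']; exact hd) ha
  have hp0 : 0 < piQ M q p := by
    rw [hpu, piQ_app hq, hU, val_append]
    have ha' : (0 : ℝ) < (a : ℕ) := by exact_mod_cast ha
    have h1 : 0 < val q [a] (piQ M q (refl p)) := by
      change 0 < ((a : ℝ) + piQ M q (refl p)) / q
      have := piQ_nonneg hq (refl p)
      positivity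
    exact (val_nonneg hq u' le_rfl).trans_lt (val_strictMono hq u' h1)
  have hrp1 : piQ M q (refl p) < M / (q - 1) := by rw [piQ_refl hq]; linarith
  have hx : 0 < piQ M q (app w p) := by
    rw [piQ_app hq]
    exact (val_nonneg hq w le_rfl).trans_lt (val_strictMono hq w hp0)
  refine ⟨hx, q, mem_Ubases_iff.2 ⟨hq, hqM, _, hd, rfl⟩, ?_⟩
  obtain ⟨n, hn⟩ := exists_pos_of_piQ_pos hx
  have hq0 : q ≠ 0 := by linarith
  have tR : Filter.Tendsto (fun r : ℝ => (M : ℝ) / (r - 1)) (nhds q) (nhds (M / (q - 1))) :=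
    tendsto_const_nhds.div (Filter.tendsto_id.sub_const 1) hq1
  have e1 : ∀ᶠ r in nhds q, val r (w ++ u) 0 < piQ M q (app w p) := by
    refine (tendsto_val Filter.tendsto_id tendsto_const_nhds hq0 _).eventually_lt_const ?_
    rw [hd', piQ_app hq]
    exact val_strictMono hq _ (by linarith)
  have e2 : ∀ᶠ r in nhds q, piQ M q (app w p) < val r (w ++ u) (M / (r - 1)) := by
    refine (tendsto_val Filter.tendsto_id tR hq0 _).eventually_const_lt ?_
    rw [hd', piQ_app hq]
    exact val_strictMono hq _ hrp1
  have e3 : ∀ᶠ r in nhds q, 1 < val r u (val r (u.map Fin.rev) (M / (r - 1))) :=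
    (tendsto_val Filter.tendsto_id (tendsto_val Filter.tendsto_id tR hq0 _)
      hq0 _).eventually_const_lt hC
  obtain ⟨ε, hε, hball⟩ := Metric.eventually_nhds_iff.1 (e1.and (e2.and e3))
  refine ⟨ε, hε, Set.Subset.antisymm ?_ ?_⟩
  · rintro r ⟨hr, hrε⟩
    rw [← Real.ball_eq_Ioo] at hrε
    obtain ⟨h1, h2, h3⟩ := hball hrε
    obtain ⟨hr1, -, e, he, hex⟩ := mem_Ubases_iff.1 hr
    rw [← hex] at h1 h2
    obtain ⟨f, rfl⟩ := he.exists_eq_app hr1 _ h1 h2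
    have hf : f = refl p := by
      refine Univoque.eq_refl_antiPeriodic hr1 ha h3 he.of_app ?_ ?_
      · refine lt_piQ_of_univoque_app (l := w ++ u') (a := a) ?_ ha
        rw [List.append_assoc, ← hU]; exact he
      · rw [← hU, ← piQ_app hr1]
        rw [app_append w u] at he
        exact piQ_lt_one_of_univoque_app he hb
    rw [hf, ← hd'] at hex
    rcases lt_trichotomy r q with h | h | h
    · exact absurd hex (piQ_lt_piQ hr1 h hn).ne'
    · exact h
    · exact absurd hex (piQ_lt_piQ hq h hn).ne
  · rintro r rfl
    exact ⟨mem_Ubases_iff.2 ⟨hq, hqM, _, hd, rfl⟩, by linarith, by linarith⟩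

lemma val_replicate_zero (m : ℕ) (y : ℝ) :
    val q (List.replicate m (0 : Fin (M + 1))) y = q⁻¹ ^ m * y := by
  induction m with
  | zero => simp [val]
  | succ m ih =>
    change (((0 : Fin (M + 1)) : ℕ) + val q (List.replicate m 0) y) / q = _
    rw [ih, pow_succ]
    simp only [Fin.val_zero, Nat.cast_zero]
    ring

lemma val_replicate_last (hq : 1 < q) (m : ℕ) (y : ℝ) :
    val q (List.replicate m (Fin.last M)) y = M / (q - 1) - q⁻¹ ^ m * (M / (q - 1) - y) := by
  have := val_rev hq (List.replicate m (0 : Fin (M + 1))) (M / (q - 1) - y)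
  rw [val_replicate_zero] at this
  simpa using this

lemma abs_val_sub_val (hq : 1 < q) (l : List (Fin (M + 1))) (y y' : ℝ) :
    |val q l y - val q l y'| = q⁻¹ ^ l.length * |y - y'| := by
  induction l with
  | nil => simp [val]
  | cons a l ih =>
    have hq0 : 0 < q⁻¹ := by positivity
    have : val q (a :: l) y - val q (a :: l) y' = q⁻¹ * (val q l y - val q l y') := by
      change ((a : ℝ) + val q l y) / q - ((a : ℝ) + val q l y') / q = _
      ring
    rw [this, abs_mul, ih, abs_of_pos hq0, List.length_cons, pow_succ]
    ring

lemma app_ofFn (d : Digits M) (n : ℕ) :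
    app (List.ofFn fun i : Fin n => d i) (fun i => d (n + i)) = d := by
  funext k
  rw [app_apply]
  split_ifs with h
  · simp
  · congr 1
    simp at h ⊢
    omega

lemma UnivoqueUpTo.replicate_zero (hq : 1 < q) {N : ℕ} {d : Digits M} (h : UnivoqueUpTo q N d)
    (hd : piQ M q d < 1) (m : ℕ) :
    UnivoqueUpTo q (N + m) (app (List.replicate m 0) d) := by
  induction m with
  | zero => exact h
  | succ m ih =>
    refine ih.cons_zero ?_
    rw [piQ_app hq, val_replicate_zero]
    have h0 := piQ_nonneg hq d
    have : q⁻¹ ^ m ≤ 1 := pow_le_one₀ (by positivity) (inv_le_one_of_one_le₀ hq.le)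
    nlinarith

/-- The value of `(M^m 0^m)^∞`. -/
lemma piQ_antiPeriodic_last (hq : 1 < q) {m : ℕ} (hm : m ≠ 0) :
    piQ M q (antiPeriodic (List.replicate m (Fin.last M))) * (1 + q⁻¹ ^ m) = M / (q - 1) := by
  have hu : List.replicate m (Fin.last M) ≠ [] := by simpa
  have := congrArg (piQ M q) (antiPeriodic_eq hu)
  rw [piQ_app hq, piQ_refl hq, val_replicate_last hq] at this
  linarith

lemma univoque_antiPeriodic_last (hq : 1 < q) {m : ℕ} (hm : m ≠ 0)
    (h : piQ M q (antiPeriodic (List.replicate m (Fin.last M))) < 1) :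
    Univoque q (antiPeriodic (List.replicate m (Fin.last M))) := by
  have hu : List.replicate m (Fin.last M) ≠ [] := by simpa
  intro N
  induction N with
  | zero => trivial
  | succ N ih =>
    have h1 := ih.replicate_zero hq h m
    obtain ⟨k, rfl⟩ := Nat.exists_eq_succ_of_ne_zero hm
    have h2 : UnivoqueUpTo q (N + 1)
        (app (List.replicate (k + 1) 0) (antiPeriodic (List.replicate (k + 1) (Fin.last M)))) := by
      have : ∀ j, UnivoqueUpTo q (N + 1 + j) (app (List.replicate (k + 1) 0)
          (antiPeriodic (List.replicate (k + 1) (Fin.last M)))) → UnivoqueUpTo q (N + 1)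
          (app (List.replicate (k + 1) 0)
          (antiPeriodic (List.replicate (k + 1) (Fin.last M)))) := by
        intro j
        induction j with
        | zero => exact id
        | succ j ihj => exact fun h => ihj h.pred
      exact this k (by rw [show N + 1 + k = N + (k + 1) by ring]; exact h1)
    have h3 := h2.refl hq
    rw [refl_app] at h3
    rw [antiPeriodic_eq hu]
    simpa using h3

lemma exists_base_near_last (hM : 0 < M) {m : ℕ} (hm : m ≠ 0) : ∃ q : ℝ, 3 / 2 ≤ q ∧ q < M + 1 ∧
    (M : ℝ) / (q - 1) = 1 + q⁻¹ ^ m - (q⁻¹ ^ m) ^ 3 / 2 := by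
  have hM1 : (1 : ℝ) ≤ M := by exact_mod_cast hM
  have hz : ∀ q : ℝ, 1 < q → 0 < q⁻¹ ^ m ∧ q⁻¹ ^ m < 1 := fun q hq =>
    ⟨by positivity, pow_lt_one₀ (by positivity) (inv_lt_one_of_one_lt₀ hq) hm⟩
  have hc : ContinuousOn (fun q : ℝ => (q - 1) * (1 + q⁻¹ ^ m - (q⁻¹ ^ m) ^ 3 / 2))
      (Set.Icc 1 (M + 1)) := by
    have : ContinuousOn (fun q : ℝ => q⁻¹) (Set.Icc 1 ((M : ℝ) + 1)) :=
      continuousOn_id.inv₀ fun x hx => by simp only [id]; linarith [hx.1]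
    fun_prop
  obtain ⟨h0, h1⟩ := hz (M + 1) (by linarith)
  obtain ⟨q, hq, hqe⟩ := intermediate_value_Ioo (by linarith) hc (show (M : ℝ) ∈ _ from
    ⟨by simp; linarith, by
      generalize ((M : ℝ) + 1)⁻¹ ^ m = z at *
      have : 0 < z - z ^ 3 / 2 := by nlinarith [mul_pos h0 h0]
      nlinarith⟩)
  obtain ⟨h0, h1⟩ := hz q hq.1
  have hR : (M : ℝ) / (q - 1) = 1 + q⁻¹ ^ m - (q⁻¹ ^ m) ^ 3 / 2 := by
    rw [div_eq_iff (by linarith [hq.1])]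
    simp only at hqe
    linarith
  refine ⟨q, ?_, hq.2, hR⟩
  generalize q⁻¹ ^ m = z at *
  have : (M : ℝ) / (q - 1) < 2 := by rw [hR]; nlinarith [pow_pos h0 3]
  rw [div_lt_iff₀ (by linarith [hq.1])] at this
  linarith

/-- Any word ending in `0` can eventually be prepended when the base tends to `M + 1` and the
values of the sequences tend to `1`. -/
lemma eventually_univoque_app {ι : Type*} {F : Filter ι} {f : ι → ℝ} {p : ι → Digits M}
    (hM : 0 < M) (hf : Filter.Tendsto f F (nhds ((M : ℝ) + 1))) (h1 : ∀ᶠ i in F, 1 < f i)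
    (hp : Filter.Tendsto (fun i => piQ M (f i) (p i)) F (nhds 1))
    (hp1 : ∀ᶠ i in F, piQ M (f i) (p i) < 1) (hu : ∀ᶠ i in F, Univoque (f i) (p i))
    (l : List (Fin (M + 1))) : ∀ᶠ i in F, Univoque (f i) (app (l ++ [0]) (p i)) := by
  have hM1 : (1 : ℝ) ≤ M := by exact_mod_cast hM
  have hMR : (M : ℝ) / (M + 1 - 1) = 1 := by rw [add_sub_cancel_right]; exact div_self (by linarith)
  induction l with
  | nil =>
    filter_upwards [hp1, hu] with i h h' N
    exact ((h' N).cons_zero h).pred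
  | cons a l ih =>
    have hl := tendsto_val hf hp (by linarith) (l ++ [0])
    have ht : (fun i => val (f i) (l ++ [0]) (piQ M (f i) (p i))) =ᶠ[F]
        fun i => piQ M (f i) (app (l ++ [0]) (p i)) := by
      filter_upwards [h1] with i hi using (piQ_app hi _ _).symm
    have hl := hl.congr' ht
    have hq : (1 : ℝ) < M + 1 := by linarith
    have hv : val ((M : ℝ) + 1) [(0 : Fin (M + 1))] 1 = 1 / (M + 1) := by simp [val]
    rw [val_append, hv] at hl
    have hlt : val ((M : ℝ) + 1) l (1 / (M + 1)) < 1 := by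
      refine (val_strictMono hq l (show (1 : ℝ) / (M + 1) < 1 from ?_)).trans_le
        ((val_le hq l (by rw [hMR])).trans_eq hMR)
      rw [div_lt_one (by linarith)]; linarith
    have hgt : 0 < val ((M : ℝ) + 1) l (1 / (M + 1)) :=
      (val_nonneg hq l le_rfl).trans_lt (val_strictMono hq l (by positivity))
    have hR : Filter.Tendsto (fun i => (M : ℝ) / (f i - 1) - 1) F (nhds 0) := by
      have := (tendsto_const_nhds (x := (M : ℝ)).div (hf.sub_const 1) (by simp; omega)).sub_const 1
      rwa [hMR, sub_self] at this
    filter_upwards [ih, hl.eventually_lt_const hlt, hR.eventually_lt hl hgt] with i h h' h'' N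
    exact ((h N).cons a h' h'').pred

lemma val_mem_closure_Xiso (hM : 0 < M) (l : List (Fin (M + 1))) :
    val ((M : ℝ) + 1) (l ++ [0]) 1 ∈ closure (Xiso M) := by
  have hM1 : (1 : ℝ) ≤ M := by exact_mod_cast hM
  choose f h1 h2 h3 using fun n : ℕ => exists_base_near_last hM n.succ_ne_zero
  have hf1 : ∀ n, 1 < f n := fun n => by linarith [h1 n]
  set z : ℕ → ℝ := fun n => (f n)⁻¹ ^ (n + 1) with hz
  have h3 : ∀ n, (M : ℝ) / (f n - 1) = 1 + z n - z n ^ 3 / 2 := h3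
  have hz0 : ∀ n, 0 < z n := fun n => pow_pos (inv_pos.2 (by linarith [hf1 n])) _
  have hzle : ∀ n, z n ≤ (2 / 3 : ℝ) ^ (n + 1) := fun n => by
    refine pow_le_pow_left₀ (inv_nonneg.2 (by linarith [hf1 n])) ?_ _
    rw [inv_le_comm₀ (by linarith [hf1 n]) (by norm_num)]
    linarith [h1 n]
  have hz1 : ∀ n, z n < 1 := fun n =>
    (hzle n).trans_lt (pow_lt_one₀ (by norm_num) (by norm_num) n.succ_ne_zero)
  have tz : Filter.Tendsto z Filter.atTop (nhds 0) :=
    squeeze_zero (fun n => (hz0 n).le) hzle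
      ((tendsto_pow_atTop_nhds_zero_of_lt_one (by norm_num) (by norm_num)).comp
        (Filter.tendsto_add_atTop_nat 1))
  have tR : Filter.Tendsto (fun n => (M : ℝ) / (f n - 1)) Filter.atTop (nhds 1) := by
    have := (tz.const_add 1).sub ((tz.pow 3).div_const 2)
    refine (this.congr fun n => (h3 n).symm).trans ?_
    simp
  have tf : Filter.Tendsto f Filter.atTop (nhds ((M : ℝ) + 1)) := by
    have := (tendsto_const_nhds (x := (M : ℝ)).div tR one_ne_zero).add_const 1
    rw [div_one] at this
    refine this.congr fun n => ?_
    have := hf1 n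
    simp only [Pi.div_apply]
    rw [div_div_cancel₀ (by linarith)]
    ring
  set p : ℕ → Digits M := fun n => antiPeriodic (List.replicate (n + 1) (Fin.last M)) with hp
  have hP : ∀ n, piQ M (f n) (p n) = M / (f n - 1) / (1 + z n) := fun n => by
    rw [eq_div_iff (by linarith [hz0 n])]
    exact piQ_antiPeriodic_last (hf1 n) n.succ_ne_zero
  have tP : Filter.Tendsto (fun n => piQ M (f n) (p n)) Filter.atTop (nhds 1) := by
    have := tR.div (tz.const_add 1) (by norm_num)
    rw [add_zero, div_one] at this
    exact this.congr fun n => (hP n).symm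
  have hP1 : ∀ n, piQ M (f n) (p n) < 1 := fun n => by
    rw [hP, div_lt_one (by linarith [hz0 n]), h3]
    linarith [pow_pos (hz0 n) 3]
  have hu : ∀ n, Univoque (f n) (p n) := fun n =>
    univoque_antiPeriodic_last (hf1 n) n.succ_ne_zero (hP1 n)
  refine mem_closure_of_tendsto (tendsto_val tf tP (by linarith) (l ++ [0])) ?_
  filter_upwards [eventually_univoque_app hM tf (.of_forall hf1) tP (.of_forall hP1)
    (.of_forall hu) l] with n hn
  have hrep : List.replicate (n + 1) (Fin.last M) = List.replicate n (Fin.last M) ++ [Fin.last M] :=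
    List.replicate_succ' ..
  rw [← piQ_app (hf1 n)]
  simp only [hp, hrep] at hn ⊢
  refine piQ_mem_Xiso (hf1 n) (h2 n).le (by simpa using hM) (by simpa using hM) ?_ hn
  rw [← hrep, List.map_replicate, Fin.rev_last, val_replicate_zero, val_replicate_last (hf1 n), h3]
  change 1 < 1 + z n - z n ^ 3 / 2 - z n * ((1 + z n - z n ^ 3 / 2) -
    z n * (1 + z n - z n ^ 3 / 2))
  have h4 := hz0 n
  have h5 := hz1 n
  have : 0 < z n ^ 3 * (1 + z n * (1 - z n)) := by
    have : 0 < 1 - z n := by linarith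
    positivity
  nlinarith

/-- Every point of `[0, 1]` is a limit of points of `X_iso`. -/
theorem Icc_subset_closure_Xiso (hM : 0 < M) : Set.Icc (0 : ℝ) 1 ⊆ closure (Xiso M) := by
  rintro y ⟨hy0, hy1⟩
  have hM1 : (1 : ℝ) ≤ M := by exact_mod_cast hM
  have hMR : (M : ℝ) / (M + 1 - 1) = 1 := by rw [add_sub_cancel_right]; exact div_self (by linarith)
  have hq : (1 : ℝ) < M + 1 := by linarith
  obtain ⟨d, rfl⟩ := exists_piQ_eq (M := M) hq le_rfl hy0 (by rwa [hMR])
  rw [← closure_closure]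
  refine mem_closure_of_tendsto (b := Filter.atTop)
    (f := fun n : ℕ => val ((M : ℝ) + 1) ((List.ofFn fun i : Fin n => d i) ++ [0]) 1) ?_
    (.of_forall fun n => val_mem_closure_Xiso hM _)
  rw [tendsto_iff_dist_tendsto_zero]
  refine squeeze_zero (g := fun n : ℕ => ((M : ℝ) + 1)⁻¹ ^ n) (fun _ => dist_nonneg) (fun n => ?_)
    (tendsto_pow_atTop_nhds_zero_of_lt_one (by positivity) (inv_lt_one_of_one_lt₀ hq))
  have he : piQ M ((M : ℝ) + 1) d = _ :=
    (congrArg (piQ M ((M : ℝ) + 1)) (app_ofFn d n)).symm.trans (piQ_app hq _ _)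
  have h0 := piQ_nonneg hq fun i => d (n + i)
  have h1 := piQ_le hq fun i => d (n + i)
  rw [hMR] at h1
  have h2 : val ((M : ℝ) + 1) [(0 : Fin (M + 1))] 1 = 1 / (M + 1) := by simp [val]
  have h3 : (1 : ℝ) / (M + 1) ≤ 1 := by rw [div_le_one (by linarith)]; linarith
  have h4 : (0 : ℝ) ≤ 1 / (M + 1) := by positivity
  rw [Real.dist_eq, he, val_append, abs_val_sub_val hq, List.length_ofFn, h2]
  refine mul_le_of_le_one_right (by positivity) ?_
  rw [abs_le]
  constructor <;> linarith

lemma piQ_const_last (hq : 1 < q) : piQ M q (fun _ => Fin.last M) = M / (q - 1) :=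
  (hasSum_const hq (M : ℝ)).tsum_eq

lemma univoque_const_last (hq : 1 < q) : Univoque q (fun _ => Fin.last M) := by
  intro N
  induction N with
  | zero => trivial
  | succ N ih =>
    refine ⟨fun h => absurd h (by simp), fun _ => ?_, ih⟩
    change _ < piQ M q (fun _ => Fin.last M)
    rw [piQ_const_last hq]
    linarith

lemma Univoque.one_eq_zero_of_zero (hq : 1 < q) (hq' : q * (q - 1) < 1) {d : Digits 1}
    (hd : Univoque q d) (h0 : d 0 = 0) : d 1 = 0 := by
  by_contra h1
  have h1 : Expansions.tail d 0 = 1 := by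
    exact Fin.eq_one_of_ne_zero _ h1
  have h2 := hd.lt_one (by simp [h0])
  have h3 := hd.tail.lt_piQ (by simp [h1])
  rw [piQ_head_tail hq, h1, div_lt_one (by linarith)] at h2
  have h4 : ((1 : ℕ) : ℝ) / (q - 1) < q := by simp at h2 h3 ⊢; linarith
  rw [div_lt_iff₀ (by linarith)] at h4
  push_cast at h4
  linarith

lemma Univoque.one_eq_zero_digit (hq : 1 < q) (hq' : q * (q - 1) < 1) {d : Digits 1}
    (hd : Univoque q d) : d 1 = d 0 := by
  rcases eq_or_ne (d 0) 0 with h | h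
  · rw [h, hd.one_eq_zero_of_zero hq hq' h]
  · have h0 : d 0 = 1 := Fin.eq_one_of_ne_zero _ h
    have h1 : (d 1).rev = 0 :=
      (hd.refl hq).one_eq_zero_of_zero hq hq' (by simp [Expansions.refl, h0])
    rw [h0, ← Fin.rev_rev (d 1), h1]
    rfl

lemma Univoque.eq_const (hq : 1 < q) (hq' : q * (q - 1) < 1) {d : Digits 1}
    (hd : Univoque q d) : d = fun _ => d 0 := by
  funext n
  induction n generalizing d with
  | zero => rfl
  | succ n ih => exact (ih hd.tail).trans (hd.one_eq_zero_digit hq hq')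

lemma mem_Xiso_of_goldenRatio_lt {x : ℝ} (hx : Real.goldenRatio < x) : x ∈ Xiso 1 := by
  have hφ := Real.one_lt_goldenRatio
  have hx0 : 0 < x := by linarith
  have hq : 1 < 1 + 1 / x := by linarith [one_div_pos.2 hx0]
  have hval : piQ 1 (1 + 1 / x) (fun _ => Fin.last 1) = x := by
    rw [piQ_const_last hq]; simp
  have hmem : 1 + 1 / x ∈ Ubases 1 x := by
    refine mem_Ubases_iff.2 ⟨hq, ?_, _, univoque_const_last hq, hval⟩
    have : 1 / x ≤ 1 := by rw [div_le_one hx0]; linarith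
    push_cast
    linarith
  refine ⟨hx0, 1 + 1 / x, hmem, ?_⟩
  have hlt : (1 + 1 / x) * (1 + 1 / x - 1) < 1 := by
    have : (1 + 1 / x) * (1 + 1 / x - 1) = (x + 1) / x ^ 2 := by field_simp; ring
    rw [this, div_lt_one (by positivity)]
    nlinarith [Real.goldenRatio_sq]
  have hc : Continuous fun r : ℝ => r * (r - 1) := by fun_prop
  obtain ⟨ε, hε, hball⟩ := Metric.eventually_nhds_iff.1
    ((hc.tendsto (1 + 1 / x)).eventually_lt_const hlt)
  refine ⟨ε, hε, Set.Subset.antisymm ?_ ?_⟩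
  · rintro r ⟨hr, hrε⟩
    rw [← Real.ball_eq_Ioo] at hrε
    obtain ⟨hr1, -, e, he, hex⟩ := mem_Ubases_iff.1 hr
    have h := he.eq_const hr1 (hball hrε)
    rcases eq_or_ne (e 0) 0 with h0 | h0
    · rw [h, h0] at hex
      simp [piQ] at hex
      linarith
    · have h0 : e 0 = Fin.last 1 := Fin.eq_one_of_ne_zero _ h0
      rw [h, h0, piQ_const_last hr1] at hex
      rw [← hex]
      simp
  · rintro r rfl
    exact ⟨hmem, by linarith, by linarith⟩

/-- `(t_n, v_n)`, where `t_0 = v_0 = 1`, `t_{n+1} = t_n v_n` and `v_{n+1}` is the reflection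
of `t_n` followed by `t_n`. -/
def doublingWords : ℕ → List (Fin 2) × List (Fin 2)
  | 0 => ([1], [1])
  | n + 1 => ((doublingWords n).1 ++ (doublingWords n).2,
      (doublingWords n).1.map Fin.rev ++ (doublingWords n).1)

/-- The word `t_n`. -/
def tWord (n : ℕ) : List (Fin 2) := (doublingWords n).1

/-- The word `v_n`. -/
def vWord (n : ℕ) : List (Fin 2) := (doublingWords n).2

/-- `q^{-2^n}`, the contraction ratio of `t_n` and `v_n`. -/
noncomputable def ratio (q : ℝ) (n : ℕ) : ℝ := (q ^ 2 ^ n)⁻¹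

/-- `1/(q-1) - fixVal q n` is the value of `v_n^∞`; moreover `fixVal q (n + 1)` is the value
of the sequence `antiPeriodic (tWord n)`. -/
noncomputable def fixVal (q : ℝ) : ℕ → ℝ
  | 0 => 0
  | n + 1 => fixVal q n + ratio q n * (1 + 1 / (q - 1) - 2 * fixVal q n) / (1 + ratio q n)

lemma tWord_succ (n : ℕ) : tWord (n + 1) = tWord n ++ vWord n := rfl

lemma vWord_succ (n : ℕ) : vWord (n + 1) = (tWord n).map Fin.rev ++ tWord n := rfl

lemma exists_words_eq_append_one (n : ℕ) :
    (∃ t, tWord n = t ++ [1]) ∧ ∃ v, vWord n = v ++ [1] := by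
  induction n with
  | zero => exact ⟨⟨[], rfl⟩, [], rfl⟩
  | succ n ih =>
    obtain ⟨⟨t, ht⟩, v, hv⟩ := ih
    exact ⟨⟨tWord n ++ v, by rw [tWord_succ, hv, List.append_assoc]⟩,
      (tWord n).map Fin.rev ++ t, by rw [vWord_succ]; nth_rw 2 [ht]; rw [List.append_assoc]⟩

lemma tWord_ne_nil (n : ℕ) : tWord n ≠ [] := by
  obtain ⟨⟨t, ht⟩, -⟩ := exists_words_eq_append_one n
  simp [ht]

lemma ratio_pos (hq : 1 < q) (n : ℕ) : 0 < ratio q n := inv_pos.2 (by positivity)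

lemma ratio_lt_one (hq : 1 < q) (n : ℕ) : ratio q n < 1 :=
  inv_lt_one_of_one_lt₀ (one_lt_pow₀ hq (by positivity))

lemma ratio_succ (q : ℝ) (n : ℕ) : ratio q (n + 1) = ratio q n ^ 2 := by
  simp [ratio, pow_succ, pow_mul]

lemma ratio_anti {r : ℝ} (hq : 1 < q) (h : q ≤ r) (n : ℕ) : ratio r n ≤ ratio q n := by
  unfold ratio
  gcongr

lemma fixVal_succ_mul (hq : 1 < q) (n : ℕ) : fixVal q (n + 1) * (1 + ratio q n) =
    fixVal q n * (1 + ratio q n) + ratio q n * (1 + 1 / (q - 1) - 2 * fixVal q n) := by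
  have := ratio_pos hq n
  rw [fixVal]
  field_simp

lemma fixVal_gap_pos (hq : 1 < q) (n : ℕ) : 0 < 1 + 1 / (q - 1) - 2 * fixVal q n := by
  induction n with
  | zero =>
    have : 0 < 1 / (q - 1) := one_div_pos.2 (by linarith)
    simp only [fixVal]
    linarith
  | succ n ih =>
    have h := fixVal_succ_mul hq n
    have h0 := ratio_pos hq n
    have h1 := ratio_lt_one hq n
    have : 0 < (1 + 1 / (q - 1) - 2 * fixVal q (n + 1)) * (1 + ratio q n) := by
      rw [sub_mul, mul_assoc, h]
      nlinarith
    exact pos_of_mul_pos_left this (by linarith)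

lemma fixVal_strictMono (hq : 1 < q) : StrictMono (fixVal q) := by
  refine strictMono_nat_of_lt_succ fun n => ?_
  have h0 := ratio_pos hq n
  have h1 := fixVal_gap_pos hq n
  have : 0 < ratio q n * (1 + 1 / (q - 1) - 2 * fixVal q n) / (1 + ratio q n) := by positivity
  rw [fixVal]
  linarith

/-- The increments of `fixVal`. -/
lemma ratio_mul_gap (hq : 1 < q) (n : ℕ) :
    ratio q n * (1 + 1 / (q - 1) - 2 * fixVal q (n + 1)) =
      (1 - ratio q n) * (fixVal q (n + 1) - fixVal q n) := by
  have h := fixVal_succ_mul hq n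
  linear_combination -h

lemma val_words (hq : 1 < q) (n : ℕ) (y : ℝ) :
    val q (tWord n) y = fixVal q n + ratio q n * (1 + y - fixVal q n) ∧
    val q (vWord n) y =
      1 / (q - 1) - fixVal q n + ratio q n * (y - (1 / (q - 1) - fixVal q n)) := by
  have hq1 : q - 1 ≠ 0 := by linarith
  have hq0 : q ≠ 0 := by linarith
  induction n generalizing y with
  | zero =>
    constructor
    · simp [val, tWord, doublingWords, fixVal, ratio]
      ring
    · simp [val, vWord, doublingWords, fixVal, ratio]
      field_simp
      ring
  | succ n ih =>
    have h := fixVal_succ_mul hq n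
    rw [tWord_succ, vWord_succ, val_append, val_append, (ih _).1, (ih _).2, ratio_succ]
    constructor
    · linear_combination (ratio q n - 1) * h
    · have h1 := val_rev hq (tWord n) (((1 : ℕ) : ℝ) / (q - 1) - val q (tWord n) y)
      rw [sub_sub_cancel, (ih _).1, (ih _).1] at h1
      rw [(ih y).1, h1, Nat.cast_one]
      linear_combination (1 - ratio q n) * h

lemma val_tWord (hq : 1 < q) (n : ℕ) (y : ℝ) :
    val q (tWord n) y = fixVal q n + ratio q n * (1 + y - fixVal q n) := (val_words hq n y).1

lemma val_vWord (hq : 1 < q) (n : ℕ) (y : ℝ) : val q (vWord n) y =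
    1 / (q - 1) - fixVal q n + ratio q n * (y - (1 / (q - 1) - fixVal q n)) := (val_words hq n y).2

lemma piQ_antiPeriodic_tWord (hq : 1 < q) (n : ℕ) :
    piQ 1 q (antiPeriodic (tWord n)) = fixVal q (n + 1) := by
  have h := congrArg (piQ 1 q) (antiPeriodic_eq (tWord_ne_nil n))
  rw [piQ_app hq, piQ_refl hq, val_tWord hq, Nat.cast_one] at h
  have h0 := ratio_pos hq n
  rw [fixVal, eq_comm, ← sub_eq_zero]
  field_simp
  linear_combination -h

lemma piQ_refl_antiPeriodic_tWord (hq : 1 < q) (n : ℕ) :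
    piQ 1 q (refl (antiPeriodic (tWord n))) = 1 / (q - 1) - fixVal q (n + 1) := by
  rw [piQ_refl hq, piQ_antiPeriodic_tWord hq, Nat.cast_one]

/-- The words `v_n` and `t_n` may be prepended to sequences of suitable value. -/
lemma UnivoqueUpTo.words (hq : 1 < q) {N : ℕ} (hN : fixVal q N < 1) {n : ℕ} (hn : n ≤ N) {K : ℕ}
    {e : Digits 1} (he : UnivoqueUpTo q K e) (h0 : 1 / (q - 1) - fixVal q N ≤ piQ 1 q e)
    (h1 : piQ 1 q e ≤ 1 / (q - 1) - fixVal q n) :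
    UnivoqueUpTo q (K + 1) (app (vWord n) e) ∧ UnivoqueUpTo q (K + 1) (app (tWord n) e) := by
  induction n generalizing K e with
  | zero =>
    have : UnivoqueUpTo q (K + 1) (Expansions.cons 1 e) :=
      ⟨fun h => absurd h (by simp [Expansions.cons]), fun _ => by
        change _ < piQ 1 q e
        rw [Nat.cast_one]
        linarith, he⟩
    exact ⟨this, this⟩
  | succ n ih =>
    have hz0 := ratio_pos hq n
    have hz1 := ratio_lt_one hq n
    have hB := fixVal_strictMono hq n.lt_succ_self
    have hBN := (fixVal_strictMono hq).monotone hn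
    have hmul := fixVal_succ_mul hq n
    have hn' : n ≤ N := by omega
    obtain ⟨hv, ht⟩ := ih hn' he h0 (by linarith)
    constructor
    · have hval : piQ 1 q (Expansions.refl (app (tWord n) e)) =
          1 / (q - 1) - (fixVal q n + ratio q n * (1 + piQ 1 q e - fixVal q n)) := by
        rw [piQ_refl hq, piQ_app hq, val_tWord hq, Nat.cast_one]
      have := (ih hn' (ht.refl hq) (by rw [hval]; nlinarith) (by
        rw [hval]
        have := piQ_nonneg hq e
        have : 0 ≤ ratio q n * (1 + piQ 1 q e - fixVal q n) := mul_nonneg hz0.le (by linarith)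
        linarith)).2.refl hq
      rw [refl_app, refl_refl, ← app_append, ← vWord_succ] at this
      exact this.pred
    · have hval : piQ 1 q (app (vWord n) e) = _ := (piQ_app hq _ _).trans (val_vWord hq _ _)
      rw [tWord_succ, app_append]
      refine (ih hn' hv ?_ ?_).2.pred
      · rw [hval]; nlinarith
      · rw [hval]; nlinarith

lemma app_flatten_succ (v : List (Fin (M + 1))) (j : ℕ) (e : Digits M) :
    app (List.replicate (j + 1) v).flatten e = app v (app (List.replicate j v).flatten e) := by
  rw [List.replicate_succ, List.flatten_cons, app_append]

lemma piQ_app_flatten_vWord (hq : 1 < q) (n j : ℕ) :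
    piQ 1 q (app (List.replicate j (vWord n)).flatten (refl (antiPeriodic (tWord n)))) =
      1 / (q - 1) - fixVal q n - ratio q n ^ j * (fixVal q (n + 1) - fixVal q n) := by
  induction j with
  | zero => simp [app, piQ_refl_antiPeriodic_tWord hq]
  | succ j ih =>
    rw [app_flatten_succ, piQ_app hq, val_vWord hq, ih, pow_succ]
    ring

lemma univoque_app_words (hq : 1 < q) {n : ℕ} (hn : fixVal q (n + 1) < 1) (j : ℕ) :
    Univoque q (app (tWord n)
      (app (List.replicate j (vWord n)).flatten (refl (antiPeriodic (tWord n))))) := by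
  have hB := fixVal_strictMono hq n.lt_succ_self
  have hz0 := ratio_pos hq n
  have hz1 := ratio_lt_one hq n
  have h0 : Univoque q (refl (antiPeriodic (tWord n))) := by
    intro K
    induction K with
    | zero => trivial
    | succ K ih =>
      have hval := piQ_refl_antiPeriodic_tWord hq n
      have := (ih.words hq hn le_rfl hval.ge hval.le).1
      rwa [vWord_succ, app_append, ← antiPeriodic_eq (tWord_ne_nil n),
        ← refl_antiPeriodic (tWord_ne_nil n)] at this
  have hval : ∀ j, 1 / (q - 1) - fixVal q (n + 1) ≤ piQ 1 q
        (app (List.replicate j (vWord n)).flatten (refl (antiPeriodic (tWord n)))) ∧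
      piQ 1 q (app (List.replicate j (vWord n)).flatten (refl (antiPeriodic (tWord n)))) ≤
        1 / (q - 1) - fixVal q n := fun j => by
    rw [piQ_app_flatten_vWord hq]
    have h2 : 0 ≤ ratio q n ^ j := by positivity
    have h3 : ratio q n ^ j ≤ 1 := pow_le_one₀ hz0.le hz1.le
    constructor <;> nlinarith
  have h1 : Univoque q
      (app (List.replicate j (vWord n)).flatten (refl (antiPeriodic (tWord n)))) := by
    induction j with
    | zero => exact h0
    | succ j ih =>
      rw [app_flatten_succ]
      exact fun K => ((ih K).words hq hn n.le_succ (hval j).1 (hval j).2).1.pred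
  exact fun K => ((h1 K).words hq hn n.le_succ (hval j).1 (hval j).2).2.pred

/-- The value of `t_n v_n^j v_{n+1}^∞`. -/
noncomputable def blockVal (n j : ℕ) (q : ℝ) : ℝ :=
  fixVal q (n + 1) + ratio q n * (1 - ratio q n ^ j) * (fixVal q (n + 1) - fixVal q n)

lemma blockVal_mem_Xiso (hq : 1 < q) (hq2 : q ≤ 2) {n : ℕ} (hn : fixVal q (n + 1) < 1)
    (hn' : 1 < fixVal q (n + 2)) (j : ℕ) : blockVal n j q ∈ Xiso 1 := by
  obtain ⟨⟨t, ht⟩, -⟩ := exists_words_eq_append_one n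
  have hrev : (tWord n).map Fin.rev = t.map Fin.rev ++ [0] := by simp [ht]
  have hu := univoque_app_words hq hn j
  have hmul := fixVal_succ_mul hq n
  have hmul' := fixVal_succ_mul hq (n + 1)
  have hz0 := ratio_pos hq n
  have hval : piQ 1 q (app (tWord n)
      (app (List.replicate j (vWord n)).flatten (refl (antiPeriodic (tWord n))))) =
      blockVal n j q := by
    rw [piQ_app hq, val_tWord hq, piQ_app_flatten_vWord hq, blockVal]
    linear_combination -hmul
  rw [refl_antiPeriodic (tWord_ne_nil n), hrev, ← app_append, ← app_append, ← List.append_assoc]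
    at hu hval
  rw [← hval]
  rw [ht] at hu ⊢
  refine piQ_mem_Xiso hq (by push_cast; linarith) (by simp) (by simp) ?_ hu
  have h1 := val_rev hq (tWord n) 0
  rw [sub_zero] at h1
  rw [← ht, h1, val_tWord hq, val_tWord hq, Nat.cast_one]
  rw [ratio_succ] at hmul'
  nlinarith [mul_lt_mul_of_pos_right hn' (by positivity : 0 < 1 + ratio q n ^ 2)]

lemma continuousOn_ratio (n : ℕ) : ContinuousOn (fun q => ratio q n) (Set.Ioi 1) := by
  refine ContinuousOn.inv₀ (by fun_prop) fun q hq => ?_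
  have : (0 : ℝ) < q := by linarith [Set.mem_Ioi.1 hq]
  positivity

lemma continuousOn_fixVal (n : ℕ) : ContinuousOn (fun q => fixVal q n) (Set.Ioi 1) := by
  induction n with
  | zero => exact continuousOn_const
  | succ n ih =>
    have hz := continuousOn_ratio n
    have hR : ContinuousOn (fun q : ℝ => 1 / (q - 1)) (Set.Ioi 1) :=
      continuousOn_const.div (by fun_prop) fun q hq => by linarith [Set.mem_Ioi.1 hq]
    refine ih.add (ContinuousOn.div (by fun_prop) (by fun_prop) fun q hq => ?_)
    linarith [ratio_pos hq n]

lemma continuousOn_blockVal (n j : ℕ) : ContinuousOn (blockVal n j) (Set.Ioi 1) := by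
  have h1 := continuousOn_ratio n
  have h2 := continuousOn_fixVal n
  have h3 := continuousOn_fixVal (n + 1)
  unfold blockVal
  fun_prop

lemma fixVal_succ_lt {r : ℝ} (hq : 1 < q) (h : q < r) (n : ℕ) :
    fixVal r (n + 1) < fixVal q (n + 1) := by
  have h0 : 0 < piQ 1 q (antiPeriodic (tWord n)) := by
    rw [piQ_antiPeriodic_tWord hq]
    exact fixVal_strictMono hq n.succ_pos
  obtain ⟨k, hk⟩ := exists_pos_of_piQ_pos h0
  rw [← piQ_antiPeriodic_tWord hq, ← piQ_antiPeriodic_tWord (hq.trans h)]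
  exact piQ_lt_piQ hq h hk

lemma fixVal_one (hq : 1 < q) : fixVal q 1 = q / (q ^ 2 - 1) := by
  have h1 : q - 1 ≠ 0 := by linarith
  have h2 : q + 1 ≠ 0 := by linarith
  have h3 : q ^ 2 - 1 ≠ 0 := by
    rw [show q ^ 2 - 1 = (q - 1) * (q + 1) by ring]
    positivity
  have h4 : q ≠ 0 := by linarith
  simp only [fixVal, ratio, pow_zero, pow_one]
  field_simp
  ring

lemma fixVal_goldenRatio_one : fixVal Real.goldenRatio 1 = 1 := by
  rw [fixVal_one Real.one_lt_goldenRatio, Real.goldenRatio_sq, add_sub_cancel_right]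
  exact div_self Real.goldenRatio_pos.ne'

lemma exists_fixVal_eq_one (n : ℕ) :
    ∃ r : ℝ, Real.goldenRatio ≤ r ∧ r ≤ 2 ∧ fixVal r (n + 1) = 1 := by
  have hφ := Real.one_lt_goldenRatio
  have hc : ContinuousOn (fun q => fixVal q (n + 1)) (Set.Icc Real.goldenRatio 2) :=
    (continuousOn_fixVal (n + 1)).mono fun q hq => hφ.trans_le hq.1
  have h1 : (1 : ℝ) ≤ fixVal Real.goldenRatio (n + 1) :=
    fixVal_goldenRatio_one.symm.trans_le ((fixVal_strictMono hφ).monotone (by omega))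
  have h2 : fixVal 2 (n + 1) ≤ 1 := by
    have := fixVal_gap_pos (q := 2) (by norm_num) (n + 1)
    norm_num at this
    linarith
  obtain ⟨r, hr, hre⟩ := intermediate_value_Icc' Real.goldenRatio_lt_two.le hc ⟨h2, h1⟩
  exact ⟨r, hr.1, hr.2, hre⟩

/-- `blockVal n 1 q` is the limit of `blockVal (n + 1) j q` as `j → ∞`. -/
lemma blockVal_one (hq : 1 < q) (n : ℕ) : blockVal n 1 q =
    fixVal q (n + 2) + ratio q (n + 1) * (fixVal q (n + 2) - fixVal q (n + 1)) := by
  have h1 := ratio_mul_gap hq n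
  have h2 := fixVal_succ_mul hq (n + 1)
  rw [ratio_succ] at *
  rw [blockVal]
  linear_combination (-ratio q n) * h1 - h2

lemma blockVal_zero_succ_le {s : ℝ} {j : ℕ} (hs : Real.goldenRatio ≤ s)
    (hs1 : fixVal s 2 = 1) (hj : j ≠ 0) :
    blockVal 0 (j + 1) s ≤ blockVal 0 j Real.goldenRatio := by
  have hφ1 : (1.61 : ℝ) < Real.goldenRatio := by
    nlinarith [Real.goldenRatio_sq, Real.one_lt_goldenRatio]
  have hφ2 : Real.goldenRatio < 1.6181 := by
    nlinarith [Real.goldenRatio_sq, Real.one_lt_goldenRatio]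
  have hs0 : 1 < s := by linarith
  have hval : ∀ q : ℝ, 1 < q → ∀ j, blockVal 0 j q =
      1 / (q - 1) - (q⁻¹) ^ (j + 1) * fixVal q 1 := fun q hq j => by
    have h := fixVal_succ_mul hq 0
    have hq1 : q - 1 ≠ 0 := by linarith
    have hq0 : q ≠ 0 := by linarith
    have h' : (q⁻¹ : ℝ) * (1 + 1 / (q - 1)) = 1 / (q - 1) := by field_simp; ring
    simp only [blockVal, fixVal, ratio, pow_zero, pow_one, zero_add] at h ⊢
    rw [pow_succ]
    linear_combination h + h'
  have hF : fixVal s 1 * (s ^ 2 - 1) = s := by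
    rw [fixVal_one hs0]
    exact div_mul_cancel₀ _ (by nlinarith)
  have hρ : 1 / (s - 1) * (s - 1) = 1 := div_mul_cancel₀ _ (by linarith)
  have hz : (s ^ 2)⁻¹ * s ^ 2 = 1 := inv_mul_cancel₀ (by positivity)
  have hcub : s * (s - 1) ^ 2 = 1 := by
    have h := fixVal_succ_mul hs0 1
    rw [hs1] at h
    simp only [ratio, pow_one] at h
    have h' : s ^ 2 = s + 1 / (s - 1) := by
      linear_combination s ^ 2 * h + hF + (-fixVal s 1 + 1 / (s - 1)) * hz
    linear_combination (s - 1) * h' + hρ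
  have hs3 : 7 / 4 ≤ s := by
    by_contra! hc
    nlinarith [mul_pos (sub_pos.2 hs0) (sub_pos.2 hc)]
  have hs4 : s ≤ 9 / 5 := by
    by_contra! hc
    nlinarith [mul_pos (sub_pos.2 hs0) (sub_pos.2 hc)]
  have hR : 1 / (s - 1) ≤ 4 / 3 := by
    rw [div_le_iff₀ (by linarith)]; linarith
  have hφi : (Real.goldenRatio)⁻¹ = Real.goldenRatio - 1 := by
    rw [Real.inv_goldenRatio]
    linarith [Real.goldenRatio_add_goldenConj]
  have hφR : 1 / (Real.goldenRatio - 1) = Real.goldenRatio := by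
    rw [← hφi, one_div, inv_inv]
  rw [hval s hs0, hval _ Real.one_lt_goldenRatio, hφR, hφi, fixVal_goldenRatio_one, mul_one]
  set φ := Real.goldenRatio
  have hsq : φ ^ 2 = φ + 1 := Real.goldenRatio_sq
  rcases j with _ | _ | j
  · exact absurd rfl hj
  · have hsi : (s⁻¹) ^ 3 * fixVal s 1 ≥ 1 / 8 := by
      have : s⁻¹ ^ 3 * fixVal s 1 = 1 / (s ^ 2 * (s ^ 2 - 1)) := by
        have h1 : s ^ 2 - 1 ≠ 0 := by nlinarith
        have h2 : s ≠ 0 := by linarith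
        rw [fixVal_one hs0]
        field_simp
      rw [this, ge_iff_le]
      have h1 : s ^ 2 ≤ 3.24 := by nlinarith
      have h2 : 0 < s ^ 2 - 1 := by nlinarith
      apply one_div_le_one_div_of_le (by positivity)
      nlinarith
    have h2 : (φ - 1) ^ 2 = 2 - φ := by linear_combination hsq
    change 1 / (s - 1) - s⁻¹ ^ 3 * fixVal s 1 ≤ φ - (φ - 1) ^ 2
    linarith
  · have h1 : 0 ≤ s⁻¹ ^ (j + 1 + 1 + 1 + 1) * fixVal s 1 :=
      mul_nonneg (by positivity) (fixVal_strictMono hs0 zero_lt_one).le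
    have h2 : (φ - 1) ^ (j + 1 + 1 + 1) ≤ (φ - 1) ^ 3 :=
      pow_le_pow_of_le_one (by linarith) (by linarith) (by omega)
    have h3 : (φ - 1) ^ 3 = 2 * φ - 3 := by linear_combination (φ - 2) * hsq
    linarith

lemma overlap_polynomial {z w : ℝ} (hz0 : 0 ≤ z) (hz : z ≤ 2 / 5) (hwz : w ≤ z) :
    -(1 - z) + (1 + z ^ 2) * (1 - w * z) ≤ (1 - z ^ 2) * (1 - w) := by
  have h2 : z ^ 2 ≤ 4 / 25 := by nlinarith
  have h3 : z ^ 3 ≤ 8 / 125 := by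
    rw [pow_succ]
    nlinarith
  have h4 : 0 ≤ z ^ 3 + z ^ 4 := by positivity
  have h5 : 0 ≤ (z - w) * (1 - z - z ^ 2 - z ^ 3) := mul_nonneg (by linarith) (by linarith)
  linarith

lemma blockVal_succ_succ_le {r s : ℝ} {n j : ℕ} (hr : Real.goldenRatio ≤ r) (hrs : r ≤ s)
    (hs2 : s ≤ 2) (hr1 : fixVal r (n + 2) = 1) (hs1 : fixVal s (n + 3) = 1) (hj : j ≠ 0) :
    blockVal (n + 1) (j + 1) s ≤ blockVal (n + 1) j r := by
  have hφ1 : (8 / 5 : ℝ) < Real.goldenRatio := by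
    nlinarith [Real.goldenRatio_sq, Real.one_lt_goldenRatio]
  have hr0 : 1 < r := by linarith
  have hs0 : 1 < s := by linarith
  have hr2 := ratio_mul_gap hr0 (n + 1)
  have hs2' := ratio_mul_gap hs0 (n + 1)
  have hs3 := ratio_mul_gap hs0 (n + 2)
  have hle : ratio s (n + 1) ≤ ratio r (n + 1) := ratio_anti hr0 hrs _
  have hz0 := ratio_pos hs0 (n + 1)
  have hz1 := ratio_lt_one hs0 (n + 1)
  have hZ1 := ratio_lt_one hr0 (n + 1)
  have hz2 : ratio s (n + 1) ≤ 2 / 5 := by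
    have h1 : s ^ 2 ≤ s ^ 2 ^ (n + 1) :=
      pow_le_pow_right₀ hs0.le (by rw [pow_succ]; have := Nat.one_le_two_pow (n := n); omega)
    unfold ratio
    rw [inv_le_comm₀ (by positivity) (by norm_num)]
    nlinarith
  have hρ : 1 / (s - 1) ≤ 1 / (r - 1) := one_div_le_one_div_of_le (by linarith) (by linarith)
  have hρ0 : 1 ≤ 1 / (s - 1) := by rw [le_div_iff₀ (by linarith)]; linarith
  rw [ratio_succ s (n + 1), show n + 2 + 1 = n + 1 + 2 from rfl, hs1] at hs3
  rw [hr1] at hr2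
  simp only [blockVal, hr1]
  generalize ratio r (n + 1) = Z at *
  generalize ratio s (n + 1) = z at *
  rw [show n + 2 = n + 1 + 1 from rfl] at hs3
  generalize fixVal s (n + 1 + 1) = b' at *
  generalize fixVal s (n + 1) = b at *
  generalize fixVal r (n + 1) = c at *
  have hG : ∀ y : ℝ, (∑ i ∈ Finset.range j, y ^ i) * (1 - y) = 1 - y ^ j := geom_sum_mul_neg
    (n := j)
  have hGZ : z * z * (∑ i ∈ Finset.range j, z ^ i) * (1 / (s - 1) - 1) ≤
      Z * Z * (∑ i ∈ Finset.range j, Z ^ i) * (1 / (r - 1) - 1) := by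
    have : 0 ≤ 1 / (s - 1) - 1 := by linarith
    have : 0 ≤ Z := by linarith
    gcongr
  have hright : Z * (1 - Z ^ j) * (1 - c) =
      Z * Z * (∑ i ∈ Finset.range j, Z ^ i) * (1 / (r - 1) - 1) := by
    rw [← hG Z]
    linear_combination (-Z * ∑ i ∈ Finset.range j, Z ^ i) * hr2
  rw [hright]
  refine le_trans ?_ (add_le_add_right hGZ 1)
  have hGz := hG z
  generalize (∑ i ∈ Finset.range j, z ^ i) = G at *
  rw [pow_succ]
  have hw0 : 0 < z ^ j := by positivity
  have hwz : z ^ j ≤ z := pow_le_of_le_one hz0.le hz1.le hj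
  generalize z ^ j = w at *
  generalize 1 / (s - 1) = R at *
  have hpos : 0 < (1 - z) * (1 - z ^ 2) := by
    have : z ^ 2 < 1 := by nlinarith
    exact mul_pos (by linarith) (by linarith)
  have hkey : (b' + z * (1 - w * z) * (b' - b)) * ((1 - z) * (1 - z ^ 2)) =
      (1 - z) * (1 - z ^ 2) + z ^ 2 * (R - 1) * (-(1 - z) + (1 + z ^ 2) * (1 - w * z)) := by
    linear_combination (-(z * (1 - w * z) * (1 - z ^ 2))) * hs2' +
      ((1 - z) - 2 * z ^ 2 * (1 - w * z)) * hs3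
  have hkey' : (1 + z * z * G * (R - 1)) * ((1 - z) * (1 - z ^ 2)) =
      (1 - z) * (1 - z ^ 2) + z ^ 2 * (R - 1) * ((1 - z ^ 2) * (1 - w)) := by
    linear_combination (z ^ 2 * (R - 1) * (1 - z ^ 2)) * hGz
  refine le_of_mul_le_mul_right ?_ hpos
  rw [hkey, hkey']
  have hR : 0 ≤ z ^ 2 * (R - 1) := mul_nonneg (by positivity) (by linarith)
  have := overlap_polynomial hz0.le hz2 hwz
  gcongr

/-- Consecutive families of values overlap. -/
lemma blockVal_succ_le {r s : ℝ} {n j : ℕ} (hr : Real.goldenRatio ≤ r) (hrs : r ≤ s)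
    (hs2 : s ≤ 2) (hr1 : fixVal r (n + 1) = 1) (hs1 : fixVal s (n + 2) = 1) (hj : j ≠ 0) :
    blockVal n (j + 1) s ≤ blockVal n j r := by
  rcases n with _ | n
  · rcases hr.eq_or_lt with rfl | h
    · exact blockVal_zero_succ_le hrs hs1 hj
    · have := fixVal_succ_lt Real.one_lt_goldenRatio h 0
      rw [fixVal_goldenRatio_one] at this
      linarith
  · exact blockVal_succ_succ_le hr hrs hs2 hr1 hs1 hj

lemma blockVal_mem_closure_Xiso {r s : ℝ} {n : ℕ} (hr : 1 < r) (hrs : r < s) (hs2 : s ≤ 2)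
    (hr1 : fixVal r (n + 1) = 1) (hs1 : fixVal s (n + 2) = 1) (j : ℕ) (hq : q ∈ Set.Icc r s) :
    blockVal n j q ∈ closure (Xiso 1) := by
  have hc : ContinuousOn (blockVal n j) (closure (Set.Ioo r s)) := by
    rw [closure_Ioo hrs.ne]
    exact (continuousOn_blockVal n j).mono fun q hq => hr.trans_le hq.1
  rw [← closure_Ioo hrs.ne] at hq
  refine closure_mono ?_ (hc.image_closure ⟨q, hq, rfl⟩)
  rintro _ ⟨p, ⟨hp, hp'⟩, rfl⟩
  have h1 := fixVal_succ_lt hr hp n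
  have h2 := fixVal_succ_lt (hr.trans hp) hp' (n + 1)
  rw [hr1] at h1
  rw [hs1] at h2
  exact blockVal_mem_Xiso (hr.trans hp) (by linarith) h1 h2 j

lemma mem_closure_Xiso_of_lt_goldenRatio {x : ℝ} (hx : 1 < x) (hxφ : x < Real.goldenRatio) :
    x ∈ closure (Xiso 1) := by
  choose r hrφ hr2 hr1 using exists_fixVal_eq_one
  have hr0 : ∀ n, 1 < r n := fun n => Real.one_lt_goldenRatio.trans_le (hrφ n)
  have hlt : ∀ n, r n < r (n + 1) := fun n => by
    by_contra! hc
    have h1 := fixVal_strictMono (hr0 n) (n + 1).lt_succ_self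
    rcases hc.eq_or_lt with h | h
    · rw [hr1 n, ← h, hr1 (n + 1)] at h1
      exact lt_irrefl _ h1
    · have h2 := fixVal_succ_lt (hr0 (n + 1)) h (n + 1)
      rw [hr1 (n + 1)] at h2
      rw [hr1 n] at h1
      linarith
  -- the supremum of the values produced by the `n`-th family
  set X : ℕ → ℝ := fun n => 1 + ratio (r n) n * (1 - fixVal (r n) n) with hX
  have hX0 : X 0 = Real.goldenRatio := by
    have h0 : r 0 = Real.goldenRatio := by
      refine ((hrφ 0).eq_or_lt.resolve_right fun h => ?_).symm
      have := fixVal_succ_lt Real.one_lt_goldenRatio h 0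
      rw [hr1 0, fixVal_goldenRatio_one] at this
      exact lt_irrefl _ this
    have h1 := Real.inv_goldenRatio
    have h2 := Real.goldenRatio_add_goldenConj
    simp only [hX, h0, ratio, fixVal, pow_zero, pow_one]
    linarith
  have hXle : ∀ n, X n ≤ 1 + (2 / 3) ^ n := fun n => by
    have h0 : 0 ≤ fixVal (r n) n := (fixVal_strictMono (hr0 n)).monotone n.zero_le
    have h1 : ratio (r n) n ≤ (2 / 3) ^ n := by
      have h2 : (3 / 2 : ℝ) ≤ r n := by
        nlinarith [Real.goldenRatio_sq, Real.one_lt_goldenRatio, hrφ n]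
      have h3 : r n ^ n ≤ r n ^ 2 ^ n := pow_le_pow_right₀ (hr0 n).le Nat.lt_two_pow_self.le
      calc ratio (r n) n ≤ (r n ^ n)⁻¹ := inv_anti₀ (pow_pos (by linarith) n) h3
        _ ≤ ((3 / 2) ^ n)⁻¹ := inv_anti₀ (by positivity) (pow_le_pow_left₀ (by norm_num) h2 n)
        _ = (2 / 3) ^ n := by rw [← inv_pow]; norm_num
    have h4 := ratio_pos (hr0 n) n
    simp only [hX]
    nlinarith
  have hex : ∃ n, X n ≤ x := by
    obtain ⟨n, hn⟩ := exists_pow_lt_of_lt_one (sub_pos.2 hx) (by norm_num : (2 / 3 : ℝ) < 1)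
    exact ⟨n, by linarith [hXle n]⟩
  obtain ⟨n, hn, hn'⟩ : ∃ n, X (n + 1) ≤ x ∧ x < X n := by
    rcases hm : Nat.find hex with _ | n
    · have := Nat.find_spec hex
      rw [hm] at this
      linarith
    · exact ⟨n, hm ▸ Nat.find_spec hex, not_le.1 (Nat.find_min hex (by omega))⟩
  have hlim : Filter.Tendsto (fun j => blockVal n (j + 1) (r n)) Filter.atTop (nhds (X n)) := by
    have h := (tendsto_pow_atTop_nhds_zero_of_lt_one (ratio_pos (hr0 n) n).le
      (ratio_lt_one (hr0 n) n)).comp (Filter.tendsto_add_atTop_nat 1)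
    have := (((h.const_sub 1).const_mul (ratio (r n) n)).mul_const
      (1 - fixVal (r n) n)).const_add 1
    rw [sub_zero, mul_one] at this
    refine this.congr fun j => ?_
    simp only [blockVal, hr1, Function.comp_apply]
  have hex' : ∃ j, x ≤ blockVal n (j + 1) (r n) :=
    ((hlim.eventually_const_lt hn').exists).imp fun _ => le_of_lt
  obtain ⟨j, hj, hj'⟩ : ∃ j, x ≤ blockVal n (j + 1) (r n) ∧
      blockVal n (j + 1) (r (n + 1)) ≤ x := by
    rcases hm : Nat.find hex' with _ | j
    · refine ⟨0, hm ▸ Nat.find_spec hex', ?_⟩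
      rw [zero_add, blockVal_one (hr0 _)]
      simpa only [hX, hr1 (n + 1)] using hn
    · refine ⟨j + 1, hm ▸ Nat.find_spec hex', ?_⟩
      refine (blockVal_succ_le (hrφ n) (hlt n).le (hr2 _) (hr1 n) (hr1 (n + 1))
        j.succ_ne_zero).trans (not_le.1 (Nat.find_min hex' (m := j) (by omega))).le
  obtain ⟨q, hq, rfl⟩ := intermediate_value_Icc' (hlt n).le
    ((continuousOn_blockVal n (j + 1)).mono fun q hq => (hr0 n).trans_le hq.1) ⟨hj', hj⟩
  exact blockVal_mem_closure_Xiso (hr0 n) (hlt n) (hr2 _) (hr1 n) (hr1 (n + 1)) _ hq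

/-- For `M = 1` every positive number is a limit of points of `X_iso`. -/
theorem Ioi_subset_closure_Xiso_one : Set.Ioi (0 : ℝ) ⊆ closure (Xiso 1) := by
  intro x hx
  rcases le_or_gt x 1 with h1 | h1
  · exact Icc_subset_closure_Xiso one_pos ⟨(Set.mem_Ioi.1 hx).le, h1⟩
  rcases lt_or_ge x Real.goldenRatio with h2 | h2
  · exact mem_closure_Xiso_of_lt_goldenRatio h1 h2
  · refine closure_mono (fun y hy => mem_Xiso_of_goldenRatio_lt hy) (s := Set.Ioi _) ?_
    rwa [closure_Ioi]

end Expansion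

/-- `X_iso` is dense in `[0,1]` for every positive integer `M`, and dense in `(0,∞)`
when `M = 1`. -/
theorem Xiso_dense (M : ℕ) (hM : 0 < M) :
    Set.Icc (0 : ℝ) 1 ⊆ closure (Xiso M) ∧
    (M = 1 → Set.Ioi (0 : ℝ) ⊆ closure (Xiso M)) := by
  refine ⟨Icc_subset_closure_Xiso hM, ?_⟩
  rintro rfl
  exact Ioi_subset_closure_Xiso_one

end Expansions
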